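/- Let n ≥ 1 and let V and V' be random variables taking values in {0, 1, …, n} with E[V] = E[V']. Then there exist (on some probability space) random variables Ṽ and Ṽ' such that Ṽ has the same distribution as V, Ṽ' has the same distribution as V', and P(Ṽ ≠ Ṽ') ≤ n · max{ P(V ≥ 2), P(V' ≥ 2) }. -/

import Mathlib

open MeasureTheory
open scoped ENNReal

lemma coup_exists (μ ν m : Measure ℕ) [IsProbabilityMeasure μ] [IsProbabilityMeasure ν]
    (h1 : m ≤ μ) (h2 : m ≤ ν) :
    ∃ ρ : Measure (ℕ × ℕ), ρ.map Prod.fst = μ ∧ ρ.map Prod.snd = ν ∧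
      ρ {x | x.1 ≠ x.2} ≤ 1 - m Set.univ := by
  have : IsFiniteMeasure m := isFiniteMeasure_of_le μ h1
  set r := 1 - m Set.univ with hr
  have hμ : (μ - m) Set.univ = r := by
    rw [Measure.sub_apply MeasurableSet.univ h1, measure_univ]
  have hν : (ν - m) Set.univ = r := by
    rw [Measure.sub_apply MeasurableSet.univ h2, measure_univ]
  have hrtop : r ≠ ∞ := ENNReal.sub_ne_top ENNReal.one_ne_top
  have key : ∀ κ : Measure ℕ, κ Set.univ = r → r⁻¹ • (r • κ) = κ := by
    intro κ hκ
    by_cases h0 : r = 0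
    · rw [h0, Measure.measure_univ_eq_zero] at hκ
      simp [hκ]
    · rw [smul_smul, ENNReal.inv_mul_cancel h0 hrtop, one_smul]
  refine ⟨m.map (fun k => (k, k)) + r⁻¹ • ((μ - m).prod (ν - m)), ?_, ?_, ?_⟩
  · rw [Measure.map_add _ _ measurable_fst, Measure.map_smul, Measure.map_fst_prod, hν,
      key _ hμ, Measure.map_map measurable_fst (by fun_prop)]
    have : (Prod.fst ∘ fun k : ℕ => (k, k)) = id := rfl
    rw [this, Measure.map_id, add_comm, Measure.sub_add_cancel_of_le h1]
  · rw [Measure.map_add _ _ measurable_snd, Measure.map_smul, Measure.map_snd_prod, hμ,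
      key _ hν, Measure.map_map measurable_snd (by fun_prop)]
    have : (Prod.snd ∘ fun k : ℕ => (k, k)) = id := rfl
    rw [this, Measure.map_id, add_comm, Measure.sub_add_cancel_of_le h2]
  · rw [Measure.add_apply, Measure.map_apply (by fun_prop) (Set.to_countable _).measurableSet]
    have : (fun k : ℕ => (k, k)) ⁻¹' {x : ℕ × ℕ | x.1 ≠ x.2} = ∅ := by ext; simp
    rw [this, measure_empty, zero_add, Measure.smul_apply]
    calc r⁻¹ • ((μ - m).prod (ν - m)) {x | x.1 ≠ x.2}
        ≤ r⁻¹ • ((μ - m).prod (ν - m)) Set.univ := by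
          gcongr
          exact Set.subset_univ _
      _ = r⁻¹ * (r * r) := by
          rw [← Set.univ_prod_univ, Measure.prod_prod, hμ, hν, smul_eq_mul]
      _ ≤ r := by
          by_cases h0 : r = 0
          · simp [h0]
          · rw [← mul_assoc, ENNReal.inv_mul_cancel h0 hrtop, one_mul]

lemma overlap_exists (μ ν : Measure ℕ) :
    ∃ m : Measure ℕ, m ≤ μ ∧ m ≤ ν ∧
      min (μ {0}) (ν {0}) + min (μ {1}) (ν {1}) ≤ m Set.univ := by
  refine ⟨Measure.sum (fun k => (min (μ {k}) (ν {k})) • Measure.dirac k), ?_, ?_, ?_⟩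
  · conv_rhs => rw [← Measure.sum_smul_dirac μ]
    refine Measure.le_iff.2 fun s hs => ?_
    rw [Measure.sum_apply _ hs, Measure.sum_apply _ hs]
    refine ENNReal.tsum_le_tsum fun k => ?_
    simp only [Measure.smul_apply, smul_eq_mul]
    gcongr
    exact min_le_left _ _
  · conv_rhs => rw [← Measure.sum_smul_dirac ν]
    refine Measure.le_iff.2 fun s hs => ?_
    rw [Measure.sum_apply _ hs, Measure.sum_apply _ hs]
    refine ENNReal.tsum_le_tsum fun k => ?_
    simp only [Measure.smul_apply, smul_eq_mul]
    gcongr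
    exact min_le_right _ _
  · rw [Measure.sum_apply _ MeasurableSet.univ]
    refine le_trans (le_of_eq ?_) (ENNReal.sum_le_tsum (Finset.range 2))
    simp [Finset.sum_range_succ]

lemma mean_facts {Ω : Type} [MeasurableSpace Ω] (μ : Measure Ω) [IsProbabilityMeasure μ]
    (n : ℕ) (V : Ω → ℕ) (hV : Measurable V) (hle : ∀ ω, V ω ≤ n) :
    μ.real (V ⁻¹' {0}) + μ.real (V ⁻¹' {1}) + μ.real {ω | 2 ≤ V ω} = 1 ∧
    μ.real (V ⁻¹' {1}) + 2 * μ.real {ω | 2 ≤ V ω} ≤ ∫ ω, (V ω : ℝ) ∂μ ∧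
    ∫ ω, (V ω : ℝ) ∂μ ≤ μ.real (V ⁻¹' {1}) + n * μ.real {ω | 2 ≤ V ω} := by
  have m0 : MeasurableSet (V ⁻¹' {0}) := hV (MeasurableSet.singleton _)
  have m1 : MeasurableSet (V ⁻¹' {1}) := hV (MeasurableSet.singleton _)
  have m2 : MeasurableSet {ω | 2 ≤ V ω} := hV (Set.to_countable {k | 2 ≤ k}).measurableSet
  have iV : Integrable (fun ω => (V ω : ℝ)) μ := by
    refine Integrable.of_bound (C := n) (by fun_prop) (Filter.Eventually.of_forall fun ω => ?_)
    simpa using hle ω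
  have hi : ∀ c : ℝ, Integrable (fun ω => (V ⁻¹' {1}).indicator (fun _ => (1:ℝ)) ω
      + {ω | 2 ≤ V ω}.indicator (fun _ => c) ω) μ := fun c =>
    ((integrable_const _).indicator m1).add ((integrable_const _).indicator m2)
  have hint : ∀ c : ℝ, ∫ ω, ((V ⁻¹' {1}).indicator (fun _ => (1:ℝ)) ω
      + {ω | 2 ≤ V ω}.indicator (fun _ => c) ω) ∂μ
      = μ.real (V ⁻¹' {1}) + c * μ.real {ω | 2 ≤ V ω} := by
    intro c
    rw [integral_add ((integrable_const _).indicator m1) ((integrable_const _).indicator m2),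
      integral_indicator_const _ m1, integral_indicator_const _ m2]
    simp [mul_comm]
  refine ⟨?_, ?_, ?_⟩
  · rw [← measureReal_union _ m1, ← measureReal_union _ m2]
    · have : V ⁻¹' {0} ∪ V ⁻¹' {1} ∪ {ω | 2 ≤ V ω} = Set.univ := by
        ext ω; simp; omega
      rw [this]; simp
    · rw [Set.disjoint_left]; intro ω; simp; omega
    · rw [Set.disjoint_left]; intro ω; simp; omega
  · rw [← hint]
    refine integral_mono (hi 2) iV fun ω => ?_
    by_cases h1 : V ω = 1
    · simp [Set.indicator, h1]
    · by_cases h2 : 2 ≤ V ω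
      · simp [Set.indicator, h1, h2]
      · simp [Set.indicator, h1, h2]
  · rw [← hint]
    refine integral_mono iV (hi n) fun ω => ?_
    by_cases h1 : V ω = 1
    · simp [Set.indicator, h1]
    · by_cases h2 : 2 ≤ V ω
      · simp [Set.indicator, h1, h2, hle ω]
      · have : V ω = 0 := by omega
        simp [Set.indicator, this]

lemma real_bound (n p0 p1 P q0 q1 Q E : ℝ) (hn : 1 ≤ n) (hP : 0 ≤ P) (hQ : 0 ≤ Q)
    (h1 : p0 + p1 + P = 1) (h2 : p1 + 2 * P ≤ E) (h3 : E ≤ p1 + n * P)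
    (h4 : q0 + q1 + Q = 1) (h5 : q1 + 2 * Q ≤ E) (h6 : E ≤ q1 + n * Q) :
    1 ≤ n * max P Q + (min p0 q0 + min p1 q1) := by
  have a : n * P ≤ n * max P Q := by gcongr; exact le_max_left _ _
  have b : n * Q ≤ n * max P Q := by gcongr; exact le_max_right _ _
  have c : P ≤ n * P := le_mul_of_one_le_left hP hn
  have d : Q ≤ n * Q := le_mul_of_one_le_left hQ hn
  rcases le_total p0 q0 with h | h <;> rcases le_total p1 q1 with h' | h' <;>
    simp only [min_eq_left h, min_eq_right h, min_eq_left h', min_eq_right h'] <;> linarith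

/-- **Lemma (coup).** If `V` and `V'` are `{0,…,n}`-valued random variables with equal
expectations, then there is a coupling `(Ṽ, Ṽ')` of their distributions with
`P(Ṽ ≠ Ṽ') ≤ n · max{P(V ≥ 2), P(V' ≥ 2)}`. -/
theorem coupling_of_equal_mean (n : ℕ) (hn : 1 ≤ n)
    (Ω₁ : Type) [MeasurableSpace Ω₁] (μ₁ : Measure Ω₁) [IsProbabilityMeasure μ₁]
    (Ω₂ : Type) [MeasurableSpace Ω₂] (μ₂ : Measure Ω₂) [IsProbabilityMeasure μ₂]
    (V : Ω₁ → ℕ) (V' : Ω₂ → ℕ)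
    (hV : Measurable V) (hV' : Measurable V')
    (hVle : ∀ ω, V ω ≤ n) (hV'le : ∀ ω, V' ω ≤ n)
    (hmean : ∫ ω, (V ω : ℝ) ∂μ₁ = ∫ ω, (V' ω : ℝ) ∂μ₂) :
    ∃ (Ω₃ : Type) (_ : MeasurableSpace Ω₃) (μ₃ : Measure Ω₃)
      (_ : IsProbabilityMeasure μ₃) (Vt Vt' : Ω₃ → ℕ),
      Measurable Vt ∧ Measurable Vt' ∧
      μ₃.map Vt = μ₁.map V ∧ μ₃.map Vt' = μ₂.map V' ∧
      μ₃ {ω | Vt ω ≠ Vt' ω} ≤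
        (n : ℝ≥0∞) * max (μ₁ {ω | 2 ≤ V ω}) (μ₂ {ω | 2 ≤ V' ω}) := by
  have : IsProbabilityMeasure (μ₁.map V) := Measure.isProbabilityMeasure_map hV.aemeasurable
  have : IsProbabilityMeasure (μ₂.map V') := Measure.isProbabilityMeasure_map hV'.aemeasurable
  obtain ⟨m, hm1, hm2, hm⟩ := overlap_exists (μ₁.map V) (μ₂.map V')
  obtain ⟨ρ, hρ1, hρ2, hρ⟩ := coup_exists _ _ m hm1 hm2
  have hprob : IsProbabilityMeasure ρ := by
    constructor
    have := measure_univ (μ := ρ.map Prod.fst) (self := by rw [hρ1]; infer_instance)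
    rwa [Measure.map_apply measurable_fst MeasurableSet.univ, Set.preimage_univ] at this
  refine ⟨ℕ × ℕ, inferInstance, ρ, hprob, Prod.fst, Prod.snd, measurable_fst, measurable_snd,
    hρ1, hρ2, hρ.trans ?_⟩
  rw [tsub_le_iff_right]
  refine le_trans ?_ (add_le_add_right hm _)
  simp only [Measure.map_apply hV (MeasurableSet.singleton _),
    Measure.map_apply hV' (MeasurableSet.singleton _)]
  obtain ⟨a1, a2, a3⟩ := mean_facts μ₁ n V hV hVle
  obtain ⟨b1, b2, b3⟩ := mean_facts μ₂ n V' hV' hV'le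
  rw [← hmean] at b2 b3
  have key := real_bound n _ _ _ _ _ _ _ (by exact_mod_cast hn) measureReal_nonneg
    measureReal_nonneg a1 a2 a3 b1 b2 b3
  have e := ENNReal.ofReal_le_ofReal key
  rw [ENNReal.ofReal_one, ENNReal.ofReal_add (by positivity) (by positivity),
    ENNReal.ofReal_add (by positivity) (by positivity), ENNReal.ofReal_mul (by positivity),
    ENNReal.ofReal_max, ENNReal.ofReal_min, ENNReal.ofReal_min, ENNReal.ofReal_natCast] at e
  simpa only [Measure.real, ENNReal.ofReal_toReal (measure_ne_top μ₁ _), ENNReal.ofReal_toReal (measure_ne_top μ₂ _)] using e
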